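/- For every state-feedback policy μ : X → U and every initial state x₀ ∈ X, the liminf average cost of the server-dependent cost problem satisfies J_(μ, x₀) ≥ min_{m ∈ S^k} g'(m). -/

import Mathlib

open Filter Finset

/-- Distribution of the chain after `t` steps under kernel `K`, started at `x₀`:
the `t`-fold monadic bind of `K` applied to the point mass at `x₀`. -/
noncomputable def chainDist {X : Type*} (K : X → PMF X) (x₀ : X) : ℕ → PMF X
  | 0 => PMF.pure x₀
  | t + 1 => (chainDist K x₀ t).bind K

/-- Expectation of `f` under a PMF on a finite type. -/
noncomputable def pmfExp {X : Type*} [Fintype X] (q : PMF X) (f : X → ℝ) : ℝ :=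
  ∑ x, (q x).toReal * f x

/-- The average cost over periods `0,…,T` of running the Markov chain with step
kernel `K` and per-stage cost `c`, started at `x₀`. -/
noncomputable def avgCost {X : Type*} [Fintype X] (K : X → PMF X) (c : X → ℝ)
    (x₀ : X) (T : ℕ) : ℝ :=
  (1 / (T + 1 : ℝ)) * ∑ t ∈ Finset.range (T + 1), pmfExp (chainDist K x₀ t) c

/-- Step kernel of the stochastic `k`-server problem under policy `μ`: server `μ x`
relocates to the request location `x.1` and the next request is drawn from `p`. -/
noncomputable def kServerKernel {S : Type*} {k : ℕ} (p : PMF S)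
    (μ : S × (Fin k → S) → Fin k) (x : S × (Fin k → S)) : PMF (S × (Fin k → S)) :=
  p.map (fun s => (s, Function.update x.2 (μ x) x.1))

/-- Per-stage cost with server-dependent travel metrics `d` and processing costs `c`:
`r(x, u) = d_u(x_u, x̂) + c_u(x̂)` evaluated at `u = μ x`. -/
noncomputable def sdCost {S : Type*} {k : ℕ} (d : Fin k → S → S → ℝ)
    (c : Fin k → S → ℝ) (μ : S × (Fin k → S) → Fin k) (x : S × (Fin k → S)) : ℝ :=
  d (μ x) (x.2 (μ x)) x.1 + c (μ x) x.1

/-- The generalized `k`-median objective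
`g'(m) = Σ_s p(s) · min_i (d_i(m_i, s) + c_i(s))`. -/
noncomputable def sdMedian {S : Type*} [Fintype S] {k : ℕ} [NeZero k]
    (p : PMF S) (d : Fin k → S → S → ℝ) (c : Fin k → S → ℝ) (m : Fin k → S) : ℝ :=
  ∑ s, (p s).toReal *
    Finset.univ.inf' Finset.univ_nonempty (fun i => d i (m i) s + c i s)

theorem pmfExp_pure {X : Type*} [Fintype X] (x : X) (f : X → ℝ) :
    pmfExp (PMF.pure x) f = f x := by
  classical
  unfold pmfExp
  rw [Finset.sum_eq_single x] <;> simp +contextual [PMF.pure_apply]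

theorem pmfExp_bind {X Y : Type*} [Fintype X] [Fintype Y] (q : PMF X) (K : X → PMF Y)
    (f : Y → ℝ) : pmfExp (q.bind K) f = pmfExp q fun x => pmfExp (K x) f := by
  have h : ∀ y, ((q.bind K) y).toReal = ∑ x, (q x).toReal * (K x y).toReal := fun y => by
    rw [PMF.bind_apply, tsum_fintype, ENNReal.toReal_sum fun x _ =>
      ENNReal.mul_ne_top (q.apply_ne_top x) ((K x).apply_ne_top y)]
    simp [ENNReal.toReal_mul]
  simp only [pmfExp, h, Finset.sum_mul, Finset.mul_sum, mul_assoc]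
  exact Finset.sum_comm

theorem pmfExp_map {X Y : Type*} [Fintype X] [Fintype Y] (q : PMF X) (g : X → Y)
    (f : Y → ℝ) : pmfExp (q.map g) f = pmfExp q fun x => f (g x) := by
  simp [PMF.map, pmfExp_bind, pmfExp_pure]

theorem pmfExp_mono {X : Type*} [Fintype X] (q : PMF X) {f g : X → ℝ} (h : ∀ x, f x ≤ g x) :
    pmfExp q f ≤ pmfExp q g :=
  Finset.sum_le_sum fun x _ => mul_le_mul_of_nonneg_left (h x) ENNReal.toReal_nonneg

theorem pmfExp_const {X : Type*} [Fintype X] (q : PMF X) (a : ℝ) :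
    pmfExp q (fun _ => a) = a := by
  have h : ∑ x, (q x).toReal = 1 := by
    rw [← ENNReal.toReal_sum fun x _ => q.apply_ne_top x,
      ← tsum_fintype (L := .unconditional X), q.tsum_coe, ENNReal.toReal_one]
  rw [pmfExp, ← Finset.sum_mul, h, one_mul]

/-- If the cost is nonnegative at the initial state and has expectation at least `V` after
one step from any state, then the liminf of the average cost is at least `V`. -/
theorem le_liminf_avgCost {X : Type*} [Fintype X] (K : X → PMF X) (r : X → ℝ) (x₀ : X) {V : ℝ}
    (h₀ : 0 ≤ r x₀) (hV : ∀ x, V ≤ pmfExp (K x) r) :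
    V ≤ liminf (avgCost K r x₀) atTop := by
  have hstep : ∀ t, V ≤ pmfExp (chainDist K x₀ (t + 1)) r := fun t => by
    rw [chainDist, pmfExp_bind]
    exact (pmfExp_const _ V).symm.le.trans (pmfExp_mono _ hV)
  have hlower : ∀ T : ℕ, V * ((T : ℝ) / (T + 1)) ≤ avgCost K r x₀ T := fun T => by
    have hsum : (T : ℝ) * V ≤ ∑ t ∈ Finset.range (T + 1), pmfExp (chainDist K x₀ t) r := by
      rw [Finset.sum_range_succ', chainDist, pmfExp_pure]
      have := Finset.card_nsmul_le_sum (Finset.range T) _ V fun t _ => hstep t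
      rw [Finset.card_range, nsmul_eq_mul] at this
      linarith
    calc V * ((T : ℝ) / (T + 1)) = 1 / (T + 1 : ℝ) * (T * V) := by ring
      _ ≤ avgCost K r x₀ T := mul_le_mul_of_nonneg_left hsum (by positivity)
  obtain ⟨B, hB⟩ := (Set.finite_range r).bddAbove
  have hupper : ∀ T : ℕ, avgCost K r x₀ T ≤ B := fun T => by
    have hsum := Finset.sum_le_card_nsmul (Finset.range (T + 1))
      (fun t => pmfExp (chainDist K x₀ t) r) B fun t _ =>
        (pmfExp_mono _ fun x => hB ⟨x, rfl⟩).trans (pmfExp_const _ B).le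
    rw [Finset.card_range, nsmul_eq_mul] at hsum
    push_cast at hsum
    rw [avgCost, one_div, inv_mul_le_iff₀ (by positivity)]
    exact hsum
  have hlim : Tendsto (fun T : ℕ => V * ((T : ℝ) / (T + 1))) atTop (nhds V) := by
    simpa using (tendsto_natCast_div_add_atTop (1 : ℝ)).const_mul V
  rw [← hlim.liminf_eq]
  exact liminf_le_liminf (Eventually.of_forall hlower) hlim.isBoundedUnder_ge
    (isBoundedUnder_of ⟨B, hupper⟩ : IsBoundedUnder (· ≤ ·) atTop _).isCoboundedUnder_ge

theorem sdMedian_le_pmfExp_sdCost {S : Type*} [Fintype S] {k : ℕ} [NeZero k] (p : PMF S)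
    (d : Fin k → S → S → ℝ) (c : Fin k → S → ℝ) (μ : S × (Fin k → S) → Fin k)
    (m : Fin k → S) :
    sdMedian p d c m ≤ pmfExp p fun s => sdCost d c μ (s, m) :=
  pmfExp_mono p fun s =>
    Finset.inf'_le (fun i => d i (m i) s + c i s) (Finset.mem_univ (μ (s, m)))

/-- For the stochastic `k`-server problem with server-dependent processing costs, the
liminf average cost of any policy is bounded below by the optimal value of the
generalized `k`-median problem. -/
theorem sd_liminf_avg_cost_ge_sdMedian_min
    {S : Type*} [Fintype S] [Nonempty S] {k : ℕ} [NeZero k]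
    (p : PMF S) (d : Fin k → S → S → ℝ) (c : Fin k → S → ℝ)
    (hd_nonneg : ∀ i a b, 0 ≤ d i a b)
    (hd_self : ∀ i a, d i a a = 0)
    (hd_symm : ∀ i a b, d i a b = d i b a)
    (hd_tri : ∀ i a b e, d i a e ≤ d i a b + d i b e)
    (hc : ∀ i s, 0 ≤ c i s)
    (μ : S × (Fin k → S) → Fin k) (x₀ : S × (Fin k → S)) :
    liminf (avgCost (kServerKernel p μ) (sdCost d c μ) x₀) atTop ≥
      Finset.univ.inf' Finset.univ_nonempty
        (fun m : Fin k → S => sdMedian p d c m) := by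
  refine le_liminf_avgCost _ _ _ (add_nonneg (hd_nonneg _ _ _) (hc _ _)) fun x => ?_
  rw [kServerKernel, pmfExp_map]
  exact (Finset.inf'_le _ (Finset.mem_univ _)).trans (sdMedian_le_pmfExp_sdCost p d c μ _)
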